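/- Consider the polynomial ring ℝ[t, x, a, b, c] and the derivations δ₁, δ₂, δ₃ determined on the generators by: δ₁(a) = 1, δ₁(c) = 1, δ₁ = 0 on t, x, b; δ₂(x) = x, δ₂(b) = −b, δ₂ = 0 on t, a, c; δ₃(a) = a, δ₃(b) = b, δ₃(c) = c, δ₃(t) = −t, δ₃(x) = 0. Then the Lie brackets satisfy ⁅δ₁, δ₂⁆ = 0, ⁅δ₂, δ₃⁆ = 0, and ⁅δ₁, δ₃⁆ = δ₁; in particular δ₁, δ₂, δ₃ span a solvable Lie algebra of derivations. -/

import Mathlib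

open MvPolynomial

/-- The three expanded affine symmetry generators of the Verhulst model with linear
predation, as derivations of `ℝ[t,x,a,b,c]` (variables indexed `0 = t`, `1 = x`,
`2 = a`, `3 = b`, `4 = c`), satisfy `⁅δ₁,δ₂⁆ = 0`, `⁅δ₂,δ₃⁆ = 0`, `⁅δ₁,δ₃⁆ = δ₁`;
in particular they span a solvable Lie algebra. -/
theorem verhulst_symmetry_generators_brackets
    (δ₁ δ₂ δ₃ : Derivation ℝ (MvPolynomial (Fin 5) ℝ) (MvPolynomial (Fin 5) ℝ))
    (h₁t : δ₁ (X 0) = 0) (h₁x : δ₁ (X 1) = 0) (h₁a : δ₁ (X 2) = 1)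
    (h₁b : δ₁ (X 3) = 0) (h₁c : δ₁ (X 4) = 1)
    (h₂t : δ₂ (X 0) = 0) (h₂x : δ₂ (X 1) = X 1) (h₂a : δ₂ (X 2) = 0)
    (h₂b : δ₂ (X 3) = -X 3) (h₂c : δ₂ (X 4) = 0)
    (h₃t : δ₃ (X 0) = -X 0) (h₃x : δ₃ (X 1) = 0) (h₃a : δ₃ (X 2) = X 2)
    (h₃b : δ₃ (X 3) = X 3) (h₃c : δ₃ (X 4) = X 4) :
    ⁅δ₁, δ₂⁆ = 0 ∧ ⁅δ₂, δ₃⁆ = 0 ∧ ⁅δ₁, δ₃⁆ = δ₁ := by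
  refine ⟨?_, ?_, ?_⟩ <;>
  · refine derivation_ext fun i => ?_
    fin_cases i <;> simp [Derivation.commutator_apply, *]
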